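/- arXiv:1802.07453 — 2 statements merged into one kernel-verified Lean document; each statement's English description precedes it below -/
import Mathlib

section
/- Let H, K : ℝ^{2n} → ℝ be smooth (autonomous). Define 𝒜(v) = ∫₀¹ p(t)·q̇(t) dt − ∫₀¹ ∫₀¹ H(v(t)) K(v(t−τ)) dτ dt on loops v = (q,p). Then every critical point v of 𝒜 satisfies v̇(t) = H̄(v) X_K(v(t)) + K̄(v) X_H(v(t)) for all t ∈ ℝ, where H̄(v) := ∫₀¹ H(v(t)) dt and K̄(v) := ∫₀¹ K(v(t)) dt. -/
open MeasureTheory intervalIntegral Real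

noncomputable section

/-- Phase space ℝ^{2n}, with points written v = (q, p). -/
abbrev Phase (n : ℕ) := (Fin n → ℝ) × (Fin n → ℝ)

/-- The standard symplectic form ω(u,w) = Σ_j (u^q_j w^p_j − u^p_j w^q_j). -/
def symForm {n : ℕ} (u w : Phase n) : ℝ :=
  ∑ j, (u.1 j * w.2 j - u.2 j * w.1 j)

/-- The Hamiltonian vector field X_H = (∂H/∂p, −∂H/∂q). -/
def hamVF {n : ℕ} (H : Phase n → ℝ) (x : Phase n) : Phase n :=
  (fun i => fderiv ℝ H x (0, Pi.single i 1),
   fun i => -fderiv ℝ H x (Pi.single i 1, 0))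

/-- A loop is a smooth 1-periodic map ℝ → ℝ^{2n}. -/
def IsLoop {n : ℕ} (v : ℝ → Phase n) : Prop :=
  ContDiff ℝ (⊤ : ℕ∞) v ∧ ∀ t, v (t + 1) = v t

/-- First variation of a functional 𝒜 at v in direction v̂. -/
def firstVariation {n : ℕ} (A : (ℝ → Phase n) → ℝ) (v vh : ℝ → Phase n) : ℝ :=
  deriv (fun s : ℝ => A (fun t => v t + s • vh t)) 0

/-- v is a critical point of 𝒜 if the first variation vanishes in all loop directions. -/
def IsCritPt {n : ℕ} (A : (ℝ → Phase n) → ℝ) (v : ℝ → Phase n) : Prop :=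
  ∀ vh, IsLoop vh → firstVariation A v vh = 0

end

/-- Differentiation under the integral sign along an affine variation of a path. -/
theorem hasDerivAt_intervalIntegral_comp_add_smul {E : Type*} [NormedAddCommGroup E]
    [NormedSpace ℝ E] {F : E → ℝ} (hF : ContDiff ℝ 1 F) {x y : ℝ → E}
    (hx : Continuous x) (hy : Continuous y) (a b : ℝ) :
    HasDerivAt (fun s : ℝ => ∫ t in a..b, F (x t + s • y t))
      (∫ t in a..b, fderiv ℝ F (x t) (y t)) 0 := by
  have hF' : Continuous (fderiv ℝ F) := hF.continuous_fderiv one_ne_zero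
  have hg : Continuous (fun z : ℝ × ℝ => fderiv ℝ F (x z.2 + z.1 • y z.2) (y z.2)) := by
    fun_prop
  obtain ⟨C, hC⟩ := ((isCompact_closedBall (0 : ℝ) 1).prod
    (isCompact_uIcc (a := a) (b := b))).exists_bound_of_continuousOn hg.continuousOn
  have hcont (s : ℝ) : Continuous (fun t => F (x t + s • y t)) := by
    have := hF.continuous
    fun_prop
  have key := intervalIntegral.hasDerivAt_integral_of_dominated_loc_of_deriv_le
    (μ := volume) (a := a) (b := b) (x₀ := (0 : ℝ)) (bound := fun _ => C)
    (F := fun s t => F (x t + s • y t))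
    (F' := fun s t => fderiv ℝ F (x t + s • y t) (y t))
    (Metric.closedBall_mem_nhds (0 : ℝ) one_pos)
    (Filter.Eventually.of_forall fun s => (hcont s).aestronglyMeasurable)
    ((hcont 0).intervalIntegrable _ _)
    (Continuous.aestronglyMeasurable (hg.comp (by fun_prop : Continuous fun t : ℝ => ((0 : ℝ), t))))
    (Filter.Eventually.of_forall fun t ht s hs => hC (s, t) ⟨hs, Set.uIoc_subset_uIcc ht⟩)
    (by simp)
    (Filter.Eventually.of_forall fun t _ s _ => by
      have h1 : HasDerivAt (fun s : ℝ => x t + s • y t) (y t) s := by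
        simpa using ((hasDerivAt_id s).smul_const (y t)).const_add (x t)
      exact ((hF.differentiable one_ne_zero).differentiableAt.hasFDerivAt).comp_hasDerivAt s h1)
  simpa using key.2

/-- The Hamiltonian vector field is dual to the differential: `dH = ω(X_H, ·)`. -/
theorem fderiv_apply_eq_symForm_hamVF {n : ℕ} (H : Phase n → ℝ) (x u : Phase n) :
    fderiv ℝ H x u = symForm (hamVF H x) u := by
  have hu : u = ∑ j, (u.1 j • ((Pi.single j 1, 0) : Phase n)
      + u.2 j • ((0, Pi.single j 1) : Phase n)) := by
    ext i <;> simp [Prod.fst_sum, Prod.snd_sum, Finset.sum_apply, Pi.single_apply]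
  conv_lhs => rw [hu]
  simp only [map_sum, map_add, map_smul, smul_eq_mul, symForm, hamVF]
  exact Finset.sum_congr rfl fun j _ => by ring

theorem contDiff_hamVF {n : ℕ} {H : Phase n → ℝ} (hH : ContDiff ℝ (⊤ : ℕ∞) H) :
    ContDiff ℝ (⊤ : ℕ∞) (hamVF H) := by
  have h : ContDiff ℝ (⊤ : ℕ∞) (fderiv ℝ H) := hH.fderiv_right (by simp)
  refine ContDiff.prodMk (contDiff_pi.2 fun i => ?_) (contDiff_pi.2 fun i => ?_)
  · exact h.clm_apply contDiff_const
  · exact (h.clm_apply contDiff_const).neg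

theorem symForm_add_left {n : ℕ} (u u' w : Phase n) :
    symForm (u + u') w = symForm u w + symForm u' w := by
  simp only [symForm, ← Finset.sum_add_distrib]
  exact Finset.sum_congr rfl fun j _ => by simp; ring

theorem symForm_smul_left {n : ℕ} (c : ℝ) (u w : Phase n) :
    symForm (c • u) w = c * symForm u w := by
  simp only [symForm, Finset.mul_sum]
  exact Finset.sum_congr rfl fun j _ => by simp; ring

theorem symForm_sub_left {n : ℕ} (u u' w : Phase n) :
    symForm (u - u') w = symForm u w - symForm u' w := by
  simp only [symForm, ← Finset.sum_sub_distrib]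
  exact Finset.sum_congr rfl fun j _ => by simp; ring

theorem Continuous.symForm {n : ℕ} {u w : ℝ → Phase n} (hu : Continuous u) (hw : Continuous w) :
    Continuous (fun t => symForm (u t) (w t)) := by
  unfold _root_.symForm
  fun_prop

namespace IsLoop

variable {n : ℕ} {v w : ℝ → Phase n}

theorem continuous (hv : IsLoop v) : Continuous v := hv.1.continuous

theorem hasDerivAt (hv : IsLoop v) (t : ℝ) : HasDerivAt v (deriv v t) t :=
  (hv.1.differentiable (by simp) t).hasDerivAt

theorem contDiff_deriv (hv : IsLoop v) : ContDiff ℝ (⊤ : ℕ∞) (deriv v) :=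
  (contDiff_infty_iff_deriv.1 hv.1).2

theorem deriv (hv : IsLoop v) : IsLoop (deriv v) := by
  refine ⟨hv.contDiff_deriv, fun t => ?_⟩
  rw [← deriv_comp_add_const]
  exact congrArg (fun f => _root_.deriv f t) (funext hv.2)

theorem add_smul (hv : IsLoop v) (hw : IsLoop w) (s : ℝ) : IsLoop (fun t => v t + s • w t) :=
  ⟨hv.1.add (hw.1.const_smul s), fun t => by simp only [hv.2, hw.2]⟩

/-- Averaging over all delays decouples the two factors of the interaction. -/
theorem integral_integral_mul_delay (hv : IsLoop v) (H K : Phase n → ℝ) :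
    ∫ t in (0 : ℝ)..1, ∫ τ in (0 : ℝ)..1, H (v t) * K (v (t - τ))
      = (∫ t in (0 : ℝ)..1, H (v t)) * ∫ t in (0 : ℝ)..1, K (v t) := by
  have h (t : ℝ) : ∫ τ in (0 : ℝ)..1, H (v t) * K (v (t - τ))
      = H (v t) * ∫ s in (0 : ℝ)..1, K (v s) := by
    rw [intervalIntegral.integral_const_mul,
      intervalIntegral.integral_comp_sub_left (fun s => K (v s)) t]
    have hp : Function.Periodic (fun s => K (v s)) 1 := fun s => by simp only [hv.2]
    have := hp.intervalIntegral_add_eq (t - 1) 0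
    simp only [sub_add_cancel, zero_add] at this
    rw [sub_zero, this]
  simp only [h, intervalIntegral.integral_mul_const]

/-- First variation of the symplectic area of a loop. -/
theorem hasDerivAt_area (hv : IsLoop v) (hw : IsLoop w) :
    HasDerivAt (fun s : ℝ => ∫ t in (0 : ℝ)..1,
        ∑ j, (v t + s • w t).2 j * (_root_.deriv (fun t => v t + s • w t) t).1 j)
      (∫ t in (0 : ℝ)..1, symForm (_root_.deriv v t) (w t)) 0 := by
  have hF : ContDiff ℝ 1 (fun z : Phase n × Phase n => ∑ j, z.1.2 j * z.2.1 j) := by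
    fun_prop
  have hd (s t : ℝ) : _root_.deriv (fun t => v t + s • w t) t
      = _root_.deriv v t + s • _root_.deriv w t :=
    ((hv.hasDerivAt t).add ((hw.hasDerivAt t).const_smul s)).deriv
  have hF' (z u : Phase n × Phase n) :
      fderiv ℝ (fun z : Phase n × Phase n => ∑ j, z.1.2 j * z.2.1 j) z u
        = ∑ j, (u.1.2 j * z.2.1 j + z.1.2 j * u.2.1 j) := by
    have h1 : HasDerivAt (fun s : ℝ => ∑ j, (z + s • u).1.2 j * (z + s • u).2.1 j)
        (∑ j, (u.1.2 j * z.2.1 j + z.1.2 j * u.2.1 j)) 0 := by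
      refine HasDerivAt.fun_sum fun j _ => ?_
      have aux (a b : ℝ) : HasDerivAt (fun s : ℝ => a + s * b) b 0 := by
        simpa using ((hasDerivAt_id (0 : ℝ)).mul_const b).const_add a
      simpa using (aux (z.1.2 j) (u.1.2 j)).fun_mul (aux (z.2.1 j) (u.2.1 j))
    have h2 : HasDerivAt (fun s : ℝ => z + s • u) u 0 := by
      simpa using ((hasDerivAt_id (0 : ℝ)).smul_const u).const_add z
    have h3 := HasFDerivAt.comp_hasDerivAt_of_eq (0 : ℝ)
      (hF.differentiable one_ne_zero z).hasFDerivAt h2 (by simp)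
    exact h3.unique h1
  have key := hasDerivAt_intervalIntegral_comp_add_smul hF
    (hv.continuous.prodMk hv.deriv.continuous) (hw.continuous.prodMk hw.deriv.continuous) 0 1
  simp only [hF'] at key
  simp only [hd]
  refine HasDerivAt.congr_deriv key ?_
  have hpq : ∫ t in (0 : ℝ)..1, ∑ j, ((_root_.deriv v t).2 j * (w t).1 j
      + (v t).2 j * (_root_.deriv w t).1 j) = 0 := by
    have hD : ∀ t ∈ Set.uIcc (0 : ℝ) 1, HasDerivAt (fun t => ∑ j, (v t).2 j * (w t).1 j)
        (∑ j, ((_root_.deriv v t).2 j * (w t).1 j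
          + (v t).2 j * (_root_.deriv w t).1 j)) t := fun t _ =>
      HasDerivAt.fun_sum fun j _ =>
        (hasDerivAt_pi.1 (hv.hasDerivAt t).snd j).mul (hasDerivAt_pi.1 (hw.hasDerivAt t).fst j)
    rw [intervalIntegral.integral_eq_sub_of_hasDerivAt hD]
    · have h1 := hv.2 0
      have h2 := hw.2 0
      rw [zero_add] at h1 h2
      simp [h1, h2]
    · have := hv.continuous
      have := hw.continuous
      have := hv.deriv.continuous
      have := hw.deriv.continuous
      exact Continuous.intervalIntegrable (by fun_prop) _ _
  rw [← sub_eq_zero, ← intervalIntegral.integral_sub]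
  · refine (intervalIntegral.integral_congr fun t _ => ?_).trans hpq
    simp only [symForm, ← Finset.sum_sub_distrib]
    exact Finset.sum_congr rfl fun j _ => by ring
  · have := hv.continuous
    have := hw.continuous
    have := hv.deriv.continuous
    have := hw.deriv.continuous
    exact Continuous.intervalIntegrable (by fun_prop) _ _
  · exact (hv.deriv.continuous.symForm hw.continuous).intervalIntegrable _ _

/-- A loop that is symplectically `L²`-orthogonal to all loops vanishes. -/
theorem eq_zero_of_forall_integral_symForm_eq_zero (hv : IsLoop v)
    (h : ∀ w, IsLoop w → ∫ t in (0 : ℝ)..1, symForm (v t) (w t) = 0) (t : ℝ) : v t = 0 := by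
  have hJ : IsLoop (fun t => ((-(v t).2, (v t).1) : Phase n)) :=
    ⟨hv.1.snd.neg.prodMk hv.1.fst, fun t => by simp only [hv.2]⟩
  have hsq (t : ℝ) : symForm (v t) (-(v t).2, (v t).1)
      = ∑ j, ((v t).1 j ^ 2 + (v t).2 j ^ 2) :=
    Finset.sum_congr rfl fun j _ => by simp; ring
  have hper : Function.Periodic (fun t => symForm (v t) (-(v t).2, (v t).1)) 1 :=
    fun t => by simp only [hv.2]
  have hint := hper.intervalIntegral_add_eq t 0
  rw [zero_add, h _ hJ] at hint
  have hnn (t : ℝ) : 0 ≤ symForm (v t) (-(v t).2, (v t).1) := by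
    rw [hsq]; positivity
  have hzero : symForm (v t) (-(v t).2, (v t).1) = 0 := by
    by_contra hne
    refine (intervalIntegral.integral_pos (lt_add_one t)
      (hv.continuous.symForm hJ.continuous).continuousOn (fun x _ => hnn x)
      ⟨t, by simp, lt_of_le_of_ne (hnn t) (Ne.symm hne)⟩).ne' hint
  rw [hsq, Finset.sum_eq_zero_iff_of_nonneg fun j _ => by positivity] at hzero
  ext j <;> have := hzero j (Finset.mem_univ j) <;> simp <;> nlinarith

end IsLoop

theorem stmt14 {n : ℕ} (hn : 1 ≤ n)
    (H K : Phase n → ℝ) (hH : ContDiff ℝ (⊤ : ℕ∞) H) (hK : ContDiff ℝ (⊤ : ℕ∞) K)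
    (v : ℝ → Phase n) (hv : IsLoop v)
    (hcrit : IsCritPt
      (fun w => (∫ t in (0:ℝ)..1, ∑ j, (w t).2 j * (deriv w t).1 j)
        - ∫ t in (0:ℝ)..1, ∫ τ in (0:ℝ)..1, H (w t) * K (w (t - τ))) v) :
    ∀ t : ℝ,
      deriv v t
        = (∫ s in (0:ℝ)..1, H (v s)) • hamVF K (v t)
          + (∫ s in (0:ℝ)..1, K (v s)) • hamVF H (v t) := by
  set h := ∫ s in (0:ℝ)..1, H (v s) with hh
  set k := ∫ s in (0:ℝ)..1, K (v s) with hk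
  have hR : IsLoop (fun t => deriv v t - (h • hamVF K (v t) + k • hamVF H (v t))) :=
    ⟨hv.contDiff_deriv.sub ((((contDiff_hamVF hK).comp hv.1).const_smul h).add
      (((contDiff_hamVF hH).comp hv.1).const_smul k)),
      fun t => by simp only [hv.2, hv.deriv.2 t]⟩
  refine fun t => sub_eq_zero.1
    (hR.eq_zero_of_forall_integral_symForm_eq_zero (fun w hw => ?_) t)
  have hHd := hasDerivAt_intervalIntegral_comp_add_smul (hH.of_le (by simp))
    hv.continuous hw.continuous 0 1
  have hKd := hasDerivAt_intervalIntegral_comp_add_smul (hK.of_le (by simp))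
    hv.continuous hw.continuous 0 1
  have hA := (hv.hasDerivAt_area hw).sub (hHd.mul hKd)
  have hcr := hcrit w hw
  simp only [firstVariation, fun s => (hv.add_smul hw s).integral_integral_mul_delay H K] at hcr
  have hval := hA.deriv.symm.trans hcr
  simp only [zero_smul, add_zero, ← hh, ← hk, fderiv_apply_eq_symForm_hamVF] at hval
  have hintegrable {u : ℝ → Phase n} (hu : Continuous u) :
      IntervalIntegrable (fun t => symForm (u t) (w t)) volume 0 1 :=
    (hu.symForm hw.continuous).intervalIntegrable _ _
  have hXH : IntervalIntegrable (fun t => symForm (hamVF H (v t)) (w t)) volume 0 1 :=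
    hintegrable ((contDiff_hamVF hH).continuous.comp hv.continuous)
  have hXK : IntervalIntegrable (fun t => symForm (hamVF K (v t)) (w t)) volume 0 1 :=
    hintegrable ((contDiff_hamVF hK).continuous.comp hv.continuous)
  simp only [symForm_sub_left, symForm_add_left, symForm_smul_left]
  rw [intervalIntegral.integral_sub (hintegrable hv.deriv.continuous)
      ((hXK.const_mul h).add (hXH.const_mul k)),
    intervalIntegral.integral_add (hXK.const_mul h) (hXH.const_mul k),
    intervalIntegral.integral_const_mul, intervalIntegral.integral_const_mul]
  linarith
end

section
/- Let H : ℝ × ℝ^{2n} → ℝ, (τ, x) ↦ H_τ(x), be smooth and 1-periodic in τ. Define 𝒜(v) = ∫₀¹ p(t)·q̇(t) dt − ∫₀¹ exp( ∫₀¹ H_τ(v(t−τ)) dτ ) dt on loops v = (q,p). Then every critical point v of 𝒜 satisfies v̇(t) = ∫₀¹ exp( ∫₀¹ H_τ(v(t+σ−τ)) dτ ) X_{H_σ}(v(t)) dσ for all t ∈ ℝ, where X_{H_σ} denotes the Hamiltonian vector field of x ↦ H_σ(x). -/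
open MeasureTheory intervalIntegral Real

open Set Filter

/-- Differentiation under an interval integral whose integrand and its derivative are jointly
continuous. -/
theorem hasDerivAt_intervalIntegral_of_continuous {f f' : ℝ → ℝ → ℝ} {a b : ℝ}
    (hf : Continuous f.uncurry) (hf' : Continuous f'.uncurry)
    (h : ∀ s t, HasDerivAt (fun s => f s t) (f' s t) s) (s₀ : ℝ) :
    HasDerivAt (fun s => ∫ t in a..b, f s t) (∫ t in a..b, f' s₀ t) s₀ := by
  have hK : IsCompact (Metric.closedBall s₀ 1 ×ˢ uIcc a b) :=
    (isCompact_closedBall s₀ 1).prod isCompact_uIcc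
  obtain ⟨C, hC⟩ := hK.exists_bound_of_continuousOn hf'.continuousOn
  have hfs : ∀ s, Continuous (f s) := fun s => hf.comp (Continuous.prodMk_right s)
  have hfs' : Continuous (f' s₀) := hf'.comp (Continuous.prodMk_right s₀)
  refine (intervalIntegral.hasDerivAt_integral_of_dominated_loc_of_deriv_le (F := f) (F' := f')
    (bound := fun _ => C)
    (Metric.closedBall_mem_nhds s₀ one_pos) (Eventually.of_forall fun s => ?_)
    ((hfs s₀).intervalIntegrable _ _) hfs'.aestronglyMeasurable
    (Eventually.of_forall fun t ht s hs => hC (s, t) ⟨hs, uIoc_subset_uIcc ht⟩)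
    intervalIntegrable_const (Eventually.of_forall fun t _ s _ => h s t)).2
  exact (hfs s).aestronglyMeasurable

/-- A smooth 1-periodic function that is nonnegative, positive at `t₀`, and supported within one
period around `t₀` in `(t₀ - δ, t₀ + δ)`. -/
theorem exists_smooth_periodic_bump (t₀ : ℝ) {δ : ℝ} (hδ : 0 < δ) (hδ' : δ ≤ 1 / 2) :
    ∃ φ : ℝ → ℝ, ContDiff ℝ (⊤ : ℕ∞) φ ∧ Function.Periodic φ 1 ∧ (∀ t, 0 ≤ φ t) ∧ 0 < φ t₀ ∧
      ∀ t, |t - t₀| ≤ 1 / 2 → δ ≤ |t - t₀| → φ t = 0 := by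
  have hcos : ∀ u, δ ≤ u → u ≤ 1 / 2 → cos (2 * π * u) ≤ cos (2 * π * δ) := fun u hu hu' =>
    cos_le_cos_of_nonneg_of_le_pi (by positivity) (by nlinarith [pi_pos]) (by gcongr)
  refine ⟨fun t => smoothTransition (cos (2 * π * (t - t₀)) - cos (2 * π * δ)), ?_, ?_,
    fun t => smoothTransition.nonneg _, ?_, ?_⟩
  · exact smoothTransition.contDiff.comp (by fun_prop)
  · intro t
    have : 2 * π * (t + 1 - t₀) = 2 * π * (t - t₀) + 2 * π := by ring
    simp only [this, cos_add_two_pi]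
  · apply smoothTransition.pos_of_pos
    have h : cos (2 * π * δ) < cos 0 :=
      cos_lt_cos_of_nonneg_of_le_pi le_rfl (by nlinarith [pi_pos]) (by positivity)
    simpa using h
  · intro t ht ht'
    apply smoothTransition.zero_of_nonpos
    have h := hcos _ ht' ht
    have e : 2 * π * |t - t₀| = |2 * π * (t - t₀)| := by
      rw [abs_mul, abs_of_pos (by positivity : (0 : ℝ) < 2 * π)]
    rw [e, cos_abs] at h
    linarith

theorem nonpos_of_forall_integral_smooth_periodic_mul_eq_zero {c : ℝ → ℝ} (hc : Continuous c)
    (hper : Function.Periodic c 1)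
    (h : ∀ φ : ℝ → ℝ, ContDiff ℝ (⊤ : ℕ∞) φ → Function.Periodic φ 1 →
      ∫ t in (0 : ℝ)..1, φ t * c t = 0) (t₀ : ℝ) : c t₀ ≤ 0 := by
  by_contra! hpos
  obtain ⟨ε, hε, hball⟩ := Metric.eventually_nhds_iff.1 (hc.continuousAt.eventually_const_lt hpos)
  obtain ⟨φ, hφ, hφper, hφ0, hφpos, hφsupp⟩ := exists_smooth_periodic_bump t₀
    (lt_min hε (by norm_num : (0 : ℝ) < 1 / 2)) (min_le_right _ _)
  have hshift := (hφper.mul hper).intervalIntegral_add_eq (t₀ - 1 / 2) 0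
  simp only [Pi.mul_apply, zero_add] at hshift
  rw [h φ hφ hφper] at hshift
  refine hshift.not_gt (intervalIntegral.integral_pos (by linarith)
    (hφ.continuous.mul hc).continuousOn (fun t ht => ?_) ⟨t₀, ⟨by linarith, by linarith⟩,
      mul_pos hφpos hpos⟩)
  rcases lt_or_ge |t - t₀| (min ε (1 / 2)) with hlt | hge
  · exact mul_nonneg (hφ0 t) (hball (hlt.trans_le (min_le_left _ _))).le
  · rw [hφsupp t (abs_le.2 ⟨by linarith [ht.1], by linarith [ht.2]⟩) hge, zero_mul]

/-- The fundamental lemma of the calculus of variations for 1-periodic functions. -/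
theorem eq_zero_of_forall_integral_smooth_periodic_mul_eq_zero {c : ℝ → ℝ} (hc : Continuous c)
    (hper : Function.Periodic c 1)
    (h : ∀ φ : ℝ → ℝ, ContDiff ℝ (⊤ : ℕ∞) φ → Function.Periodic φ 1 →
      ∫ t in (0 : ℝ)..1, φ t * c t = 0) (t : ℝ) : c t = 0 := by
  refine le_antisymm (nonpos_of_forall_integral_smooth_periodic_mul_eq_zero hc hper h t) ?_
  have := nonpos_of_forall_integral_smooth_periodic_mul_eq_zero (c := fun t => -c t) hc.neg
    (fun t => by simp only [hper t]) (fun φ hφ hφ' => by simp [h φ hφ hφ']) t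
  linarith

/-- Integration by parts over a period. -/
theorem integral_mul_deriv_of_periodic {f g f' g' : ℝ → ℝ} (hf : ∀ t, HasDerivAt f (f' t) t)
    (hg : ∀ t, HasDerivAt g (g' t) t) (hf' : Continuous f') (hg' : Continuous g')
    (hfper : Function.Periodic f 1) (hgper : Function.Periodic g 1) :
    ∫ t in (0 : ℝ)..1, f t * g' t = -∫ t in (0 : ℝ)..1, f' t * g t := by
  rw [intervalIntegral.integral_mul_deriv_eq_deriv_mul (fun t _ => hf t) (fun t _ => hg t)
    (hf'.intervalIntegrable _ _) (hg'.intervalIntegrable _ _)]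
  have h1 := hfper 0
  have h2 := hgper 0
  rw [zero_add] at h1 h2
  rw [h1, h2]
  ring

/-- Moving a delay from one factor to an advance in the other under an integral over a period. -/
theorem integral_mul_integral_delay {f : ℝ → ℝ} {g : ℝ → ℝ → ℝ} (hf : Continuous f)
    (hg : Continuous g.uncurry) (hfper : Function.Periodic f 1)
    (hgper : ∀ σ, Function.Periodic (g σ) 1) :
    ∫ t in (0 : ℝ)..1, f t * ∫ τ in (0 : ℝ)..1, g τ (t - τ)
      = ∫ t in (0 : ℝ)..1, ∫ σ in (0 : ℝ)..1, f (t + σ) * g σ t := by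
  have hcont : Continuous (Function.uncurry fun t τ => f t * g τ (t - τ)) :=
    (hf.comp continuous_fst).mul
      (hg.comp (f := fun z : ℝ × ℝ => (z.2, z.1 - z.2)) (by fun_prop))
  have hcont' : Continuous (Function.uncurry fun σ t => f (t + σ) * g σ t) :=
    (hf.comp (f := fun z : ℝ × ℝ => z.2 + z.1) (by fun_prop)).mul hg
  have hint : ∀ F : ℝ → ℝ → ℝ, Continuous F.uncurry →
      IntegrableOn F.uncurry (uIoc (0 : ℝ) 1 ×ˢ uIoc (0 : ℝ) 1) := fun F hF =>
    (hF.continuousOn.integrableOn_compact (isCompact_uIcc.prod isCompact_uIcc)).mono_set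
      (prod_mono uIoc_subset_uIcc uIoc_subset_uIcc)
  simp only [← intervalIntegral.integral_const_mul]
  rw [intervalIntegral_intervalIntegral_swap (hint _ hcont),
    ← intervalIntegral_intervalIntegral_swap (hint _ hcont')]
  refine intervalIntegral.integral_congr fun σ _ => ?_
  have hper : Function.Periodic (fun t => f (t + σ) * g σ t) 1 := fun t => by
    simp only [hgper σ t, add_right_comm t 1 σ, hfper (t + σ)]
  have h1 := intervalIntegral.integral_comp_sub_right (a := 0) (b := 1)
    (fun t => f (t + σ) * g σ t) σ
  simp only [sub_add_cancel] at h1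
  have h2 := hper.intervalIntegral_add_eq (0 - σ) 0
  rw [show 0 - σ + 1 = 1 - σ by ring, zero_add] at h2
  simp only [h1, h2]

section Action

variable {n : ℕ} {H : ℝ → Phase n → ℝ}

theorem hasFDerivAt_slice (hH : ContDiff ℝ (⊤ : ℕ∞) (fun z : ℝ × Phase n => H z.1 z.2))
    (τ : ℝ) (x : Phase n) :
    HasFDerivAt (H τ) (fderiv ℝ (H τ) x) x := by
  have : DifferentiableAt ℝ (H τ) x :=
    ((hH.differentiable (by simp)).comp (differentiable_const τ |>.prodMk differentiable_id)) x
  exact this.hasFDerivAt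

theorem continuous_fderiv_slice
    (hH : ContDiff ℝ (⊤ : ℕ∞) (fun z : ℝ × Phase n => H z.1 z.2)) :
    Continuous fun z : (ℝ × Phase n) × Phase n => fderiv ℝ (H z.1.1) z.1.2 z.2 := by
  have hD : ∀ z : ℝ × Phase n, ∀ e, fderiv ℝ (H z.1) z.2 e
      = fderiv ℝ (fun z : ℝ × Phase n => H z.1 z.2) z (0, e) := by
    intro z e
    have hin : HasFDerivAt (fun x => (z.1, x)) (ContinuousLinearMap.inr ℝ ℝ (Phase n)) z.2 :=
      hasFDerivAt_prodMk_right z.1 z.2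
    have h := HasFDerivAt.comp (g := fun z : ℝ × Phase n => H z.1 z.2) z.2
      ((hH.differentiable (by simp)) z).hasFDerivAt hin
    exact congrArg (fun L : Phase n →L[ℝ] ℝ => L e) h.fderiv
  simp only [hD]
  have := hH.continuous_fderiv (by simp)
  exact (this.comp continuous_fst).clm_apply (by fun_prop)

theorem hasDerivAt_integral_slice_line
    (hH : ContDiff ℝ (⊤ : ℕ∞) (fun z : ℝ × Phase n => H z.1 z.2)) {v w : ℝ → Phase n}
    (hv : Continuous v) (hw : Continuous w) (t s : ℝ) :
    HasDerivAt (fun s : ℝ => ∫ τ in (0 : ℝ)..1, H τ (v (t - τ) + s • w (t - τ)))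
      (∫ τ in (0 : ℝ)..1, fderiv ℝ (H τ) (v (t - τ) + s • w (t - τ)) (w (t - τ))) s := by
  refine hasDerivAt_intervalIntegral_of_continuous
    (f := fun s τ => H τ (v (t - τ) + s • w (t - τ)))
    (f' := fun s τ => fderiv ℝ (H τ) (v (t - τ) + s • w (t - τ)) (w (t - τ))) ?_ ?_ ?_ s
  · exact hH.continuous.comp
      (f := fun z : ℝ × ℝ => (z.2, v (t - z.2) + z.1 • w (t - z.2))) (by fun_prop)
  · exact (continuous_fderiv_slice hH).comp
      (f := fun z : ℝ × ℝ => ((z.2, v (t - z.2) + z.1 • w (t - z.2)), w (t - z.2)))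
      (by fun_prop)
  · intro s τ
    have hl : HasDerivAt (fun s : ℝ => v (t - τ) + s • w (t - τ)) (w (t - τ)) s := by
      simpa using ((hasDerivAt_id s).smul_const (w (t - τ))).const_add (v (t - τ))
    exact (hasFDerivAt_slice hH τ _).comp_hasDerivAt s hl

theorem hasDerivAt_integral_exp_integral_slice_line
    (hH : ContDiff ℝ (⊤ : ℕ∞) (fun z : ℝ × Phase n => H z.1 z.2)) {v w : ℝ → Phase n}
    (hv : Continuous v) (hw : Continuous w) (s : ℝ) :
    HasDerivAt (fun s : ℝ => ∫ t in (0 : ℝ)..1,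
        exp (∫ τ in (0 : ℝ)..1, H τ (v (t - τ) + s • w (t - τ))))
      (∫ t in (0 : ℝ)..1, exp (∫ τ in (0 : ℝ)..1, H τ (v (t - τ) + s • w (t - τ)))
        * ∫ τ in (0 : ℝ)..1, fderiv ℝ (H τ) (v (t - τ) + s • w (t - τ)) (w (t - τ))) s := by
  have h1 : Continuous fun z : ℝ × ℝ =>
      exp (∫ τ in (0 : ℝ)..1, H τ (v (z.2 - τ) + z.1 • w (z.2 - τ))) := by
    refine (intervalIntegral.continuous_parametric_intervalIntegral_of_continuous' ?_ 0 1).rexp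
    exact hH.continuous.comp (f := fun y : (ℝ × ℝ) × ℝ =>
      (y.2, v (y.1.2 - y.2) + y.1.1 • w (y.1.2 - y.2))) (by fun_prop)
  have h2 : Continuous fun z : ℝ × ℝ => ∫ τ in (0 : ℝ)..1,
      fderiv ℝ (H τ) (v (z.2 - τ) + z.1 • w (z.2 - τ)) (w (z.2 - τ)) := by
    refine intervalIntegral.continuous_parametric_intervalIntegral_of_continuous' ?_ 0 1
    exact (continuous_fderiv_slice hH).comp (f := fun y : (ℝ × ℝ) × ℝ =>
      ((y.2, v (y.1.2 - y.2) + y.1.1 • w (y.1.2 - y.2)), w (y.1.2 - y.2))) (by fun_prop)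
  exact hasDerivAt_intervalIntegral_of_continuous
    (f := fun s t => exp (∫ τ in (0 : ℝ)..1, H τ (v (t - τ) + s • w (t - τ))))
    (f' := fun s t => exp (∫ τ in (0 : ℝ)..1, H τ (v (t - τ) + s • w (t - τ)))
      * ∫ τ in (0 : ℝ)..1, fderiv ℝ (H τ) (v (t - τ) + s • w (t - τ)) (w (t - τ)))
    h1 (h1.mul h2)
    (fun s t => (hasDerivAt_integral_slice_line hH hv hw t s).exp) s

theorem hasDerivAt_integral_liouville_line {v w : ℝ → Phase n}
    (hv : ContDiff ℝ (⊤ : ℕ∞) v) (hw : ContDiff ℝ (⊤ : ℕ∞) w) :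
    HasDerivAt (fun s : ℝ => ∫ t in (0 : ℝ)..1,
        ∑ j, (v t + s • w t).2 j * (deriv (fun t => v t + s • w t) t).1 j)
      (∫ t in (0 : ℝ)..1, ∑ j, ((w t).2 j * (deriv v t).1 j + (v t).2 j * (deriv w t).1 j)) 0 := by
  have hv0 := hv.continuous
  have hw0 := hw.continuous
  have hv1 : Continuous (deriv v) := hv.continuous_deriv (by simp)
  have hw1 : Continuous (deriv w) := hw.continuous_deriv (by simp)
  have hd : ∀ s t : ℝ, deriv (fun t => v t + s • w t) t = deriv v t + s • deriv w t := fun s t =>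
    (((hv.differentiable (by simp)) t).hasDerivAt.add
      (((hw.differentiable (by simp)) t).hasDerivAt.const_smul s)).deriv
  simp only [hd, Prod.fst_add, Prod.snd_add, Prod.smul_fst, Prod.smul_snd, Pi.add_apply,
    Pi.smul_apply, smul_eq_mul]
  have key := hasDerivAt_intervalIntegral_of_continuous (a := 0) (b := 1)
    (f := fun s t => ∑ j, ((v t).2 j + s * (w t).2 j) * ((deriv v t).1 j + s * (deriv w t).1 j))
    (f' := fun s t => ∑ j, ((w t).2 j * ((deriv v t).1 j + s * (deriv w t).1 j)
      + ((v t).2 j + s * (w t).2 j) * (deriv w t).1 j))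
    (by unfold Function.uncurry; fun_prop) (by unfold Function.uncurry; fun_prop) (fun s t => ?_) 0
  · simpa using key
  · refine HasDerivAt.fun_sum fun j _ => ?_
    have hl : ∀ a b : ℝ, HasDerivAt (fun s : ℝ => a + s * b) b s := fun a b => by
      simpa using ((hasDerivAt_id s).mul_const b).const_add a
    exact (hl _ _).mul (hl _ _)

theorem firstVariation_action
    (hH : ContDiff ℝ (⊤ : ℕ∞) (fun z : ℝ × Phase n => H z.1 z.2)) {v w : ℝ → Phase n}
    (hv : ContDiff ℝ (⊤ : ℕ∞) v) (hw : ContDiff ℝ (⊤ : ℕ∞) w) :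
    firstVariation (fun w => (∫ t in (0:ℝ)..1, ∑ j, (w t).2 j * (deriv w t).1 j)
        - ∫ t in (0:ℝ)..1, Real.exp (∫ τ in (0:ℝ)..1, H τ (w (t - τ)))) v w
      = (∫ t in (0 : ℝ)..1, ∑ j, ((w t).2 j * (deriv v t).1 j + (v t).2 j * (deriv w t).1 j))
        - ∫ t in (0 : ℝ)..1, exp (∫ τ in (0 : ℝ)..1, H τ (v (t - τ)))
          * ∫ τ in (0 : ℝ)..1, fderiv ℝ (H τ) (v (t - τ)) (w (t - τ)) := by
  have h := ((hasDerivAt_integral_liouville_line hv hw).sub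
    (hasDerivAt_integral_exp_integral_slice_line hH hv.continuous hw.continuous 0)).deriv
  simp only [zero_smul, add_zero] at h
  exact h

theorem continuous_integral_delay
    (hH : ContDiff ℝ (⊤ : ℕ∞) (fun z : ℝ × Phase n => H z.1 z.2)) {v : ℝ → Phase n}
    (hv : Continuous v) : Continuous fun t => exp (∫ τ in (0 : ℝ)..1, H τ (v (t - τ))) := by
  refine (intervalIntegral.continuous_parametric_intervalIntegral_of_continuous' ?_ 0 1).rexp
  exact hH.continuous.comp (f := fun y : ℝ × ℝ => (y.2, v (y.1 - y.2))) (by fun_prop)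

/-- The Euler–Lagrange equation of the delay action functional, tested against a fixed vector. -/
theorem euler_lagrange_delay_action
    (hH : ContDiff ℝ (⊤ : ℕ∞) (fun z : ℝ × Phase n => H z.1 z.2)) {v : ℝ → Phase n}
    (hv : IsLoop v)
    (hcrit : IsCritPt
      (fun w => (∫ t in (0:ℝ)..1, ∑ j, (w t).2 j * (deriv w t).1 j)
        - ∫ t in (0:ℝ)..1, Real.exp (∫ τ in (0:ℝ)..1, H τ (w (t - τ)))) v)
    (e : Phase n) (t : ℝ) :
    symForm (deriv v t) e = ∫ σ in (0 : ℝ)..1,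
      exp (∫ τ in (0 : ℝ)..1, H τ (v (t + σ - τ))) * fderiv ℝ (H σ) (v t) e := by
  obtain ⟨hvs, hvper⟩ := hv
  have hv0 := hvs.continuous
  have hv1 : Continuous (deriv v) := hvs.continuous_deriv (by simp)
  have hvd : ∀ t, HasDerivAt v (deriv v t) t := fun t =>
    ((hvs.differentiable (by simp)) t).hasDerivAt
  have hdper : Function.Periodic (deriv v) 1 := fun t => by
    rw [← deriv_comp_add_const]
    simp only [hvper]
  have hf := continuous_integral_delay hH hv0
  have hfper : Function.Periodic (fun t => exp (∫ τ in (0 : ℝ)..1, H τ (v (t - τ)))) 1 :=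
    fun t => by simp only [add_sub_right_comm t 1, hvper]
  have hD : Continuous fun z : ℝ × ℝ => fderiv ℝ (H z.2) (v z.1) e :=
    (continuous_fderiv_slice hH).comp (f := fun z : ℝ × ℝ => ((z.2, v z.1), e)) (by fun_prop)
  have hfD : Continuous fun z : ℝ × ℝ =>
      exp (∫ τ in (0 : ℝ)..1, H τ (v (z.1 + z.2 - τ))) * fderiv ℝ (H z.2) (v z.1) e :=
    (hf.comp (f := fun z : ℝ × ℝ => z.1 + z.2) (by fun_prop)).mul hD
  have hR : Continuous fun t => ∫ σ in (0 : ℝ)..1,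
      exp (∫ τ in (0 : ℝ)..1, H τ (v (t + σ - τ))) * fderiv ℝ (H σ) (v t) e :=
    intervalIntegral.continuous_parametric_intervalIntegral_of_continuous' hfD 0 1
  have hS : Continuous fun t => symForm (deriv v t) e := by
    unfold symForm
    fun_prop
  rw [← sub_eq_zero]
  refine eq_zero_of_forall_integral_smooth_periodic_mul_eq_zero
    (c := fun t => symForm (deriv v t) e - ∫ σ in (0 : ℝ)..1,
      exp (∫ τ in (0 : ℝ)..1, H τ (v (t + σ - τ))) * fderiv ℝ (H σ) (v t) e)
    (hS.sub hR) (fun t => ?_) (fun φ hφ hφper => ?_) t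
  · simp only [hdper t, hvper t, add_right_comm t 1, add_sub_right_comm _ (1 : ℝ), hvper]
  have hφ0 := hφ.continuous
  have hφ1 : Continuous (deriv φ) := hφ.continuous_deriv (by simp)
  have hφd : ∀ t, HasDerivAt φ (deriv φ t) t := fun t =>
    ((hφ.differentiable (by simp)) t).hasDerivAt
  have hw : ContDiff ℝ (⊤ : ℕ∞) fun t => φ t • e := hφ.smul contDiff_const
  have hwd : ∀ t, deriv (fun t => φ t • e) t = deriv φ t • e := fun t =>
    ((hφd t).smul_const e).deriv
  have h0 := hcrit (fun t => φ t • e) ⟨hw, fun t => by simp only [hφper t]⟩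
  rw [firstVariation_action hH hvs hw, integral_mul_integral_delay
    (g := fun τ t => fderiv ℝ (H τ) (v t) (φ t • e)) hf
    ((continuous_fderiv_slice hH).comp (f := fun z : ℝ × ℝ => ((z.1, v z.2), φ z.2 • e))
      (by fun_prop)) hfper (fun σ t => by simp only [hvper t, hφper t])] at h0
  have hfirst : (∫ t in (0 : ℝ)..1,
      ∑ j, ((φ t • e).2 j * (deriv v t).1 j + (v t).2 j * (deriv (fun t => φ t • e) t).1 j))
      = ∫ t in (0 : ℝ)..1, φ t * symForm (deriv v t) e := by
    simp only [symForm, Finset.mul_sum, hwd, Prod.smul_fst, Prod.smul_snd, Pi.smul_apply,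
      smul_eq_mul]
    rw [intervalIntegral.integral_finsetSum
        (fun j _ => Continuous.intervalIntegrable (by fun_prop) _ _),
      intervalIntegral.integral_finsetSum
        (fun j _ => Continuous.intervalIntegrable (by fun_prop) _ _)]
    refine Finset.sum_congr rfl fun j _ => ?_
    have hp : ∀ t, HasDerivAt (fun t => (v t).2 j) ((deriv v t).2 j) t := fun t =>
      hasDerivAt_pi.1 (((ContinuousLinearMap.snd ℝ (Fin n → ℝ) (Fin n → ℝ)).hasFDerivAt
        (x := v t)).comp_hasDerivAt t (hvd t)) j
    have hparts := integral_mul_deriv_of_periodic hp (fun t => (hφd t).mul_const (e.1 j))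
      (by fun_prop) (by fun_prop) (fun t => by simp only [hvper t])
      (fun t => by simp only [hφper t])
    rw [intervalIntegral.integral_add (Continuous.intervalIntegrable (by fun_prop) _ _)
      (Continuous.intervalIntegrable (by fun_prop) _ _), hparts, ← sub_eq_add_neg,
      ← intervalIntegral.integral_sub (Continuous.intervalIntegrable (by fun_prop) _ _)
      (Continuous.intervalIntegrable (by fun_prop) _ _)]
    exact intervalIntegral.integral_congr fun t _ => by ring
  rw [hfirst, ← intervalIntegral.integral_sub (Continuous.intervalIntegrable (by fun_prop) _ _)
    (Continuous.intervalIntegrable ?_ _ _)] at h0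
  · refine Eq.trans ?_ h0
    refine intervalIntegral.integral_congr fun t _ => ?_
    simp only [map_smul, smul_eq_mul, mul_sub, ← intervalIntegral.integral_const_mul]
    congr 1
    exact intervalIntegral.integral_congr fun σ _ => by ring
  · simp only [map_smul, smul_eq_mul, mul_left_comm _ (φ _), intervalIntegral.integral_const_mul]
    exact hφ0.mul hR

theorem continuous_hamVF_slice
    (hH : ContDiff ℝ (⊤ : ℕ∞) (fun z : ℝ × Phase n => H z.1 z.2)) (x : Phase n) :
    Continuous fun σ => hamVF (H σ) x := by
  have h : ∀ e, Continuous fun σ => fderiv ℝ (H σ) x e := fun e =>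
    (continuous_fderiv_slice hH).comp (f := fun σ : ℝ => ((σ, x), e)) (by fun_prop)
  exact (continuous_pi fun i => h _).prodMk (continuous_pi fun i => (h _).neg)

end Action

theorem stmt16 {n : ℕ} (hn : 1 ≤ n)
    (H : ℝ → Phase n → ℝ)
    (hH : ContDiff ℝ (⊤ : ℕ∞) (fun z : ℝ × Phase n => H z.1 z.2))
    (hHper : ∀ τ x, H (τ + 1) x = H τ x)
    (v : ℝ → Phase n) (hv : IsLoop v)
    (hcrit : IsCritPt
      (fun w => (∫ t in (0:ℝ)..1, ∑ j, (w t).2 j * (deriv w t).1 j)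
        - ∫ t in (0:ℝ)..1, Real.exp (∫ τ in (0:ℝ)..1, H τ (w (t - τ)))) v) :
    ∀ t : ℝ,
      deriv v t
        = ∫ σ in (0:ℝ)..1,
            Real.exp (∫ τ in (0:ℝ)..1, H τ (v (t + σ - τ))) • hamVF (H σ) (v t) := by
  intro t
  have hf := continuous_integral_delay hH hv.1.continuous
  have hint : IntervalIntegrable (fun σ => exp (∫ τ in (0:ℝ)..1, H τ (v (t + σ - τ))) •
      hamVF (H σ) (v t)) volume 0 1 :=
    ((hf.comp (continuous_const.add continuous_id)).smul
      (continuous_hamVF_slice hH (v t))).intervalIntegrable _ _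
  have hEL := fun e => euler_lagrange_delay_action hH hv hcrit e t
  refine Prod.ext (funext fun i => ?_) (funext fun i => ?_)
  · have h := ((ContinuousLinearMap.proj (R := ℝ) (φ := fun _ : Fin n => ℝ) i).comp
      (ContinuousLinearMap.fst ℝ (Fin n → ℝ) (Fin n → ℝ))).intervalIntegral_comp_comm hint
    refine Eq.trans ?_ h
    simpa [symForm, hamVF, Pi.single_apply] using hEL (0, Pi.single i 1)
  · have h := ((ContinuousLinearMap.proj (R := ℝ) (φ := fun _ : Fin n => ℝ) i).comp
      (ContinuousLinearMap.snd ℝ (Fin n → ℝ) (Fin n → ℝ))).intervalIntegral_comp_comm hint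
    refine Eq.trans ?_ h
    have := hEL (Pi.single i 1, 0)
    simp only [symForm, Pi.zero_apply, mul_zero, zero_sub, Finset.sum_neg_distrib,
      Pi.single_apply, mul_ite, mul_one, Finset.sum_ite_eq',
      Finset.mem_univ, if_true] at this
    simp [hamVF, ← this]
end
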